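/- arXiv:2308.01628 — 2 statements merged into one kernel-verified Lean document; each statement's English description precedes it below -/
import Mathlib

section
/- If F is continuous at a point q₀ ∈ ℝ, then the function L(q) = ∫_ℝ (ρ_τ(y − q) − ρ_τ(y)) dμ(y) is differentiable at q₀ with derivative L'(q₀) = F(q₀) − τ. -/
open MeasureTheory

/-- The check (quantile) loss `ρ_τ(u) = u·(τ − 1{u < 0})`. -/
noncomputable def rho (τ u : ℝ) : ℝ := u * (τ - if u < 0 then 1 else 0)

lemma rho_of_neg {τ u : ℝ} (hu : u < 0) : rho τ u = (τ - 1) * u := by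
  simp [rho, hu, mul_comm]

lemma rho_of_nonneg {τ u : ℝ} (hu : 0 ≤ u) : rho τ u = τ * u := by
  simp [rho, hu.not_gt, mul_comm]

lemma abs_rho_sub_rho_le {τ : ℝ} (hτ0 : 0 ≤ τ) (hτ1 : τ ≤ 1) (u v : ℝ) :
    |rho τ u - rho τ v| ≤ |u - v| := by
  rcases lt_or_ge u 0 with hu | hu <;> rcases lt_or_ge v 0 with hv | hv <;>
    simp only [rho_of_neg, rho_of_nonneg, hu, hv] <;>
    rw [abs_le] <;> constructor <;> cases abs_cases (u - v) <;> nlinarith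

lemma measurable_rho (τ : ℝ) : Measurable (rho τ) :=
  measurable_id.mul (measurable_const.sub
    (Measurable.ite measurableSet_Iio measurable_const measurable_const))

lemma hasDerivAt_rho_sub {τ y q : ℝ} (hy : y ≠ q) :
    HasDerivAt (fun q => rho τ (y - q)) ((Set.Iic q).indicator 1 y - τ) q := by
  have hlin (c : ℝ) : HasDerivAt (fun q => c * (y - q)) (-c) q := by
    simpa using ((hasDerivAt_id q).const_sub y).const_mul c
  rcases hy.lt_or_gt with h | h
  · have hd : (Set.Iic q).indicator 1 y - τ = -(τ - 1) := by simp [h.le]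
    rw [hd]
    refine (hlin (τ - 1)).congr_of_eventuallyEq ?_
    filter_upwards [lt_mem_nhds h] with x hx using rho_of_neg (sub_neg.2 hx)
  · have hd : (Set.Iic q).indicator 1 y - τ = -τ := by simp [h]
    rw [hd]
    refine (hlin τ).congr_of_eventuallyEq ?_
    filter_upwards [gt_mem_nhds h] with x hx using rho_of_nonneg (sub_nonneg.2 hx.le)

lemma measure_singleton_eq_zero_of_continuousAt_cdf {μ : Measure ℝ} [IsProbabilityMeasure μ]
    {q : ℝ} (h : ContinuousAt (ProbabilityTheory.cdf μ) q) : μ {q} = 0 := by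
  rw [← ProbabilityTheory.measure_cdf μ, StieltjesFunction.measure_singleton,
    h.continuousWithinAt.leftLim_eq, sub_self, ENNReal.ofReal_zero]

/-- If the CDF `F` of `μ` is continuous at `q₀`, then the population check-loss criterion
`L(q) = ∫ (ρ_τ(y − q) − ρ_τ(y)) dμ(y)` is differentiable at `q₀` with `L'(q₀) = F(q₀) − τ`. -/
theorem check_loss_derivative
    (τ : ℝ) (hτ0 : 0 < τ) (hτ1 : τ < 1)
    (μ : Measure ℝ) [IsProbabilityMeasure μ]
    (F : ℝ → ℝ) (hF : ∀ t, F t = (μ (Set.Iic t)).toReal)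
    (q₀ : ℝ) (hcont : ContinuousAt F q₀) :
    HasDerivAt (fun q => ∫ y, (rho τ (y - q) - rho τ y) ∂μ) (F q₀ - τ) q₀ := by
  have hFcdf : F = ProbabilityTheory.cdf μ := by
    ext t
    rw [hF, ProbabilityTheory.cdf_eq_real, measureReal_def]
  have hne : ∀ᵐ y ∂μ, y ≠ q₀ := by
    simpa [ae_iff] using measure_singleton_eq_zero_of_continuousAt_cdf (hFcdf ▸ hcont)
  have hmeas (q : ℝ) : Measurable fun y => rho τ (y - q) - rho τ y :=
    ((measurable_rho τ).comp (measurable_id.sub_const q)).sub (measurable_rho τ)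
  have hind : Integrable ((Set.Iic q₀).indicator (1 : ℝ → ℝ)) μ :=
    (integrable_const (1 : ℝ)).indicator measurableSet_Iic
  have hint : ∫ y, ((Set.Iic q₀).indicator 1 y - τ) ∂μ = F q₀ - τ := by
    rw [integral_sub hind (integrable_const τ), integral_indicator_one measurableSet_Iic, hF]
    simp [measureReal_def]
  rw [← hint]
  refine (hasDerivAt_integral_of_dominated_loc_of_lip (bound := fun _ => 1) Filter.univ_mem
    (.of_forall fun q => (hmeas q).aestronglyMeasurable) ?_
    (hind.sub (integrable_const τ)).aestronglyMeasurable (.of_forall fun y => ?_)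
    (integrable_const 1) ?_).2
  · refine (integrable_const |q₀|).mono' (hmeas q₀).aestronglyMeasurable (.of_forall fun y => ?_)
    simpa using abs_rho_sub_rho_le hτ0.le hτ1.le (y - q₀) y
  · refine LipschitzOnWith.of_dist_le_mul fun q _ r _ => ?_
    simpa [Real.dist_eq, abs_sub_comm] using abs_rho_sub_rho_le hτ0.le hτ1.le (y - q) (y - r)
  · filter_upwards [hne] with y hy using (hasDerivAt_rho_sub hy).sub_const _
end

section
/- Let g_n : ℝ → ℝ (n ∈ ℕ) be convex functions and g : ℝ → ℝ a function with a unique strict global minimizer x₀ (i.e., g(x₀) < g(x) for all x ≠ x₀). Suppose g_n(x) → g(x) as n → ∞ for every x ∈ ℝ, and let x_n ∈ ℝ be a global minimizer of g_n for each n (g_n(x_n) ≤ g_n(y) for all y ∈ ℝ). Then x_n → x₀. -/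
/-- A convex function does not exceed its value at `a` anywhere on the segment joining `a` to a
minimizer. -/
theorem ConvexOn.notMem_segment_of_lt_of_isMinOn {E : Type*} [AddCommGroup E] [Module ℝ E]
    {s : Set E} {f : E → ℝ} {a b z : E} (hf : ConvexOn ℝ s f) (hz : IsMinOn f s z)
    (ha : a ∈ s) (hzs : z ∈ s) (hab : f a < f b) : b ∉ segment ℝ a z := fun hb =>
  hab.not_ge <| (hf.le_on_segment ha hzs hb).trans (max_le le_rfl (hz ha))

/-- Argmin convergence for convex objectives: if convex `gₙ : ℝ → ℝ` converge pointwise to `g`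
having a unique strict global minimizer `x₀`, and `xₙ` is a global minimizer of `gₙ`, then
`xₙ → x₀`. -/
theorem convex_argmin_convergence
    (g : ℕ → ℝ → ℝ) (hconvex : ∀ n, ConvexOn ℝ Set.univ (g n))
    (glim : ℝ → ℝ) (x₀ : ℝ) (hmin : ∀ x ≠ x₀, glim x₀ < glim x)
    (hpt : ∀ x : ℝ, Filter.Tendsto (fun n => g n x) Filter.atTop (nhds (glim x)))
    (x : ℕ → ℝ) (hxmin : ∀ n, ∀ y : ℝ, g n (x n) ≤ g n y) :
    Filter.Tendsto x Filter.atTop (nhds x₀) := by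
  have hlt : ∀ b ≠ x₀, ∀ᶠ n in Filter.atTop, b ∉ segment ℝ x₀ (x n) := fun b hb =>
    ((hpt x₀).eventually_lt (hpt b) (hmin b hb)).mono fun n hn =>
      (hconvex n).notMem_segment_of_lt_of_isMinOn (fun y _ => hxmin n y) trivial trivial hn
  refine tendsto_order.2 ⟨fun b hb => ?_, fun b hb => ?_⟩
  · filter_upwards [hlt b hb.ne] with n hn
    by_contra! hle
    rw [segment_symm, segment_eq_Icc (hle.trans hb.le)] at hn
    exact hn ⟨hle, hb.le⟩
  · filter_upwards [hlt b hb.ne'] with n hn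
    by_contra! hle
    rw [segment_eq_Icc (hb.le.trans hle)] at hn
    exact hn ⟨hb.le, hle⟩
end
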